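/- Let (X,d) be a compact metric space, T : X → X a continuous map, and φ ∈ C(X,ℝ). Then the maximum ergodic average satisfies α(φ) = sup_{x∈X} limsup_{n→∞} S_nφ(x)/n. -/

import Mathlib

open MeasureTheory Filter Topology

/-- The Birkhoff sum `S_n φ(x) = ∑_{i=0}^{n-1} φ(T^i x)`. -/
noncomputable def birkhoffAvgSum {X : Type*} [TopologicalSpace X] (T : X → X) (φ : C(X, ℝ)) (n : ℕ) (x : X) : ℝ :=
  ∑ i ∈ Finset.range n, φ (T^[i] x)

/-- The maximum ergodic average `α(φ) = sup_{μ ∈ M_T(X)} ∫ φ dμ`. -/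
noncomputable def maxErgAvg {X : Type*} [MetricSpace X] [MeasurableSpace X] [BorelSpace X]
    (T : X → X) (φ : C(X, ℝ)) : ℝ :=
  sSup {r : ℝ | ∃ μ : Measure X, IsProbabilityMeasure μ ∧ μ.map T = μ ∧ r = ∫ x, φ x ∂μ}

lemma bas_abs_le {X : Type*} [MetricSpace X] [CompactSpace X] (T : X → X) (φ : C(X, ℝ))
    (n : ℕ) (x : X) : |birkhoffAvgSum T φ n x / n| ≤ ‖φ‖ := by
  rcases Nat.eq_zero_or_pos n with rfl | hn
  · simp
  have hn' : (0 : ℝ) < n := by exact_mod_cast hn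
  rw [abs_div, abs_of_pos hn', div_le_iff₀ hn']
  unfold birkhoffAvgSum
  calc |∑ i ∈ Finset.range n, φ (T^[i] x)| ≤ ∑ i ∈ Finset.range n, |φ (T^[i] x)| :=
        Finset.abs_sum_le_sum_abs _ _
    _ ≤ ∑ i ∈ Finset.range n, ‖φ‖ :=
        Finset.sum_le_sum (fun i _ => by simpa using φ.norm_coe_le_norm (T^[i] x))
    _ = ‖φ‖ * n := by simp [mul_comm]

lemma bas_bdd {X : Type*} [MetricSpace X] [CompactSpace X] (T : X → X) (φ : C(X, ℝ)) (x : X) :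
    IsBoundedUnder (· ≤ ·) atTop (fun n : ℕ => birkhoffAvgSum T φ n x / n) :=
  isBoundedUnder_of ⟨‖φ‖, fun n => (abs_le.1 (bas_abs_le T φ n x)).2⟩

lemma bas_bdd' {X : Type*} [MetricSpace X] [CompactSpace X] (T : X → X) (φ : C(X, ℝ)) (x : X) :
    IsBoundedUnder (· ≥ ·) atTop (fun n : ℕ => birkhoffAvgSum T φ n x / n) :=
  isBoundedUnder_of ⟨-‖φ‖, fun n => (abs_le.1 (bas_abs_le T φ n x)).1⟩

/-- Krylov–Bogolyubov construction. -/
lemma exists_inv {X : Type*} [MetricSpace X] [CompactSpace X]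
    [MeasurableSpace X] [BorelSpace X] (T : X → X) (hT : Continuous T) (φ : C(X, ℝ)) (x : X)
    (c : ℝ) (hc : c < limsup (fun n : ℕ => birkhoffAvgSum T φ n x / n) atTop) :
    ∃ μ : Measure X, IsProbabilityMeasure μ ∧ μ.map T = μ ∧ c ≤ ∫ x, φ x ∂μ := by
  let m : ℕ → Measure X := fun n =>
    ((n + 1 : ℕ) : ENNReal)⁻¹ • ∑ i ∈ Finset.range (n + 1), Measure.dirac (T^[i] x)
  have hm : ∀ n, IsProbabilityMeasure (m n) := fun n => ⟨by
    simp only [m, Measure.smul_apply, Measure.finsetSum_apply, measure_univ, Finset.sum_const,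
      Finset.card_range, smul_eq_mul, nsmul_eq_mul, mul_one]
    exact ENNReal.inv_mul_cancel (by simp) (ENNReal.natCast_ne_top _)⟩
  have hint : ∀ n (f : C(X, ℝ)), ∫ y, f y ∂(m n) =
      birkhoffAvgSum T f (n + 1) x / (n + 1 : ℕ) := by
    intro n f
    simp only [m]
    rw [integral_smul_measure, integral_finsetSum_measure]
    · rw [ENNReal.toReal_inv, ENNReal.toReal_natCast]
      simp only [integral_dirac, birkhoffAvgSum, div_eq_inv_mul, smul_eq_mul]
    · intro i _
      exact f.continuous.integrable_of_hasCompactSupport (HasCompactSupport.of_compactSpace _)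
  let p : ℕ → ProbabilityMeasure X := fun n => ⟨m n, hm n⟩
  rw [← limsup_nat_add _ 1] at hc
  have hfr := frequently_lt_of_lt_limsup
    (isBoundedUnder_of ⟨-‖φ‖, fun n => (abs_le.1 (bas_abs_le T φ (n + 1) x)).1⟩).isCoboundedUnder_le hc
  have hne : NeBot (atTop ⊓ 𝓟 {n : ℕ | c < birkhoffAvgSum T φ (n + 1) x / (n + 1 : ℕ)}) := frequently_mem_iff_neBot.1 hfr
  obtain ⟨U, hU0⟩ := Ultrafilter.exists_le (atTop ⊓ 𝓟 {n : ℕ | c < birkhoffAvgSum T φ (n + 1) x / (n + 1 : ℕ)})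
  have hU := hU0.trans inf_le_left
  have hUc : ∀ᶠ n in (U : Filter ℕ), c < birkhoffAvgSum T φ (n + 1) x / (n + 1 : ℕ) :=
    le_principal_iff.1 (hU0.trans inf_le_right)
  obtain ⟨μ, -, hμ⟩ := isCompact_univ.ultrafilter_le_nhds (U.map p) (by simp)
  have hlim : ∀ f : C(X, ℝ), Tendsto (fun n : ℕ => birkhoffAvgSum T f (n + 1) x / (n + 1 : ℕ)) U
      (𝓝 (∫ y, f y ∂(μ : Measure X))) := by
    intro f
    have := (ProbabilityMeasure.tendsto_iff_forall_integral_tendsto.1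
      (show Tendsto p U (𝓝 μ) from hμ)) (BoundedContinuousFunction.mkOfCompact f)
    refine this.congr (fun n => ?_)
    exact hint n f
  refine ⟨μ, inferInstance, ?_, ?_⟩
  · have : IsFiniteMeasure ((μ : Measure X).map T) := inferInstance
    apply ext_of_forall_integral_eq_of_IsFiniteMeasure
    intro f
    rw [integral_map hT.aemeasurable f.continuous.aestronglyMeasurable]
    have h1 := hlim (f.toContinuousMap.comp ⟨T, hT⟩)
    have h2 := hlim f.toContinuousMap
    have h3 := h1.sub h2
    have h4 : Tendsto (fun n : ℕ => birkhoffAvgSum T (f.toContinuousMap.comp ⟨T, hT⟩) (n + 1) x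
        / (n + 1 : ℕ) - birkhoffAvgSum T f.toContinuousMap (n + 1) x / (n + 1 : ℕ)) atTop (𝓝 0) := by
      have h5 : Tendsto (fun n : ℕ => (2 * ‖f‖) / ((n + 1 : ℕ) : ℝ)) atTop (𝓝 0) :=
        (tendsto_add_atTop_iff_nat (f := fun n : ℕ => (2 * ‖f‖) / (n : ℝ)) 1).2
          (tendsto_const_div_atTop_nhds_zero_nat _)
      refine squeeze_zero_norm (fun n => ?_) h5
      rw [← sub_div, norm_div, Real.norm_natCast]
      gcongr
      have : birkhoffAvgSum T (f.toContinuousMap.comp ⟨T, hT⟩) (n + 1) x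
          - birkhoffAvgSum T f.toContinuousMap (n + 1) x = f (T^[n+1] x) - f x := by
        unfold birkhoffAvgSum
        rw [← Finset.sum_sub_distrib]
        have := Finset.sum_range_sub (fun i => f (T^[i] x)) (n + 1)
        simp only [Function.iterate_zero, id] at this
        rw [← this]
        refine Finset.sum_congr rfl fun i _ => ?_
        rw [Function.iterate_succ_apply']
        rfl
      rw [this]
      calc ‖f (T^[n+1] x) - f x‖ ≤ ‖f (T^[n+1] x)‖ + ‖f x‖ := norm_sub_le _ _
        _ ≤ ‖f‖ + ‖f‖ := add_le_add (f.norm_coe_le_norm _) (f.norm_coe_le_norm _)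
        _ = _ := by ring
    have h6 := tendsto_nhds_unique h3 (h4.mono_left hU)
    exact sub_eq_zero.1 h6
  · exact ge_of_tendsto (hlim φ) (hUc.mono fun n hn => le_of_lt hn)

lemma int_le {X : Type*} [MetricSpace X] [CompactSpace X]
    [MeasurableSpace X] [BorelSpace X] (T : X → X) (hT : Continuous T) (φ : C(X, ℝ))
    (s : ℝ) (hs : ∀ x, limsup (fun n : ℕ => birkhoffAvgSum T φ n x / n) atTop ≤ s)
    (μ : Measure X) [IsProbabilityMeasure μ] (hμ : μ.map T = μ) : ∫ x, φ x ∂μ ≤ s := by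
  have hmp : MeasurePreserving T μ μ := ⟨hT.measurable, hμ⟩
  have hi : ∀ f : X → ℝ, Continuous f → Integrable f μ := fun f hf =>
    hf.integrable_of_hasCompactSupport (HasCompactSupport.of_compactSpace _)
  have hcont : ∀ n : ℕ, Continuous (fun x => birkhoffAvgSum T φ n x / n) := by
    intro n
    unfold birkhoffAvgSum
    exact (continuous_finsetSum _ fun i _ => φ.continuous.comp (hT.iterate i)).div_const _
  have hA : ∀ n : ℕ, 0 < n → ∫ x, birkhoffAvgSum T φ n x / n ∂μ = ∫ x, φ x ∂μ := by
    intro n hn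
    rw [integral_div]
    unfold birkhoffAvgSum
    rw [integral_finsetSum _ (fun i _ => hi (fun x => φ (T^[i] x)) (φ.continuous.comp (hT.iterate i)))]
    have : ∀ i ∈ Finset.range n, ∫ x, φ (T^[i] x) ∂μ = ∫ x, φ x ∂μ := by
      intro i _
      have h := (hmp.iterate i)
      conv_rhs => rw [← h.map_eq]
      rw [integral_map h.measurable.aemeasurable φ.continuous.aestronglyMeasurable]
    rw [Finset.sum_congr rfl this]
    have : (n : ℝ) ≠ 0 := by positivity
    simp
    field_simp
  have hcm : ∀ n : ℕ, Continuous (fun x => max (birkhoffAvgSum T φ n x / n - s) 0) :=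
    fun n => ((hcont n).sub continuous_const).max continuous_const
  have hD : Tendsto (fun n : ℕ => ∫ x, max (birkhoffAvgSum T φ n x / n - s) 0 ∂μ) atTop
      (𝓝 (∫ x, (0 : ℝ) ∂μ)) := by
    refine tendsto_integral_of_dominated_convergence (fun _ => ‖φ‖ + |s|)
      (fun n => (hcm n).aestronglyMeasurable) (integrable_const _) (fun n => ?_) ?_
    · refine Eventually.of_forall fun x => ?_
      rw [Real.norm_eq_abs, abs_of_nonneg (le_max_right _ _)]
      refine max_le ?_ (by positivity)
      have := (abs_le.1 (bas_abs_le T φ n x)).2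
      have := neg_abs_le s
      linarith
    · refine Eventually.of_forall fun x => ?_
      rw [Metric.tendsto_nhds]
      intro ε hε
      have := eventually_lt_of_limsup_lt (lt_of_le_of_lt (hs x) (lt_add_of_pos_right s hε))
        (bas_bdd T φ x)
      filter_upwards [this] with n hn
      rw [Real.dist_eq, sub_zero, abs_of_nonneg (le_max_right _ _)]
      exact max_lt (by linarith) hε
  rw [integral_zero] at hD
  have : ∫ x, φ x ∂μ - s ≤ 0 := by
    refine ge_of_tendsto hD ?_
    filter_upwards [eventually_gt_atTop 0] with n hn
    calc ∫ x, φ x ∂μ - s = ∫ x, (birkhoffAvgSum T φ n x / n - s) ∂μ := by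
          rw [integral_sub (hi _ (hcont n)) (integrable_const _), hA n hn]; simp
      _ ≤ _ := integral_mono (hi _ ((hcont n).sub continuous_const)) (hi _ (hcm n))
          (fun x => le_max_left _ _)
  linarith

/-- `α(φ) = sup_{x∈X} limsup_{n→∞} S_nφ(x)/n`. -/
theorem maxErgAvg_eq_sup_limsup {X : Type*} [MetricSpace X] [CompactSpace X] [Nonempty X]
    [MeasurableSpace X] [BorelSpace X] (T : X → X) (hT : Continuous T) (φ : C(X, ℝ)) :
    maxErgAvg T φ =
      ⨆ x : X, limsup (fun n : ℕ => birkhoffAvgSum T φ n x / n) atTop := by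
  have hbdd : BddAbove (Set.range fun x : X =>
      limsup (fun n : ℕ => birkhoffAvgSum T φ n x / n) atTop) := by
    refine ⟨‖φ‖, ?_⟩
    rintro _ ⟨x, rfl⟩
    exact limsup_le_of_le (bas_bdd' T φ x).isCoboundedUnder_le
      (Eventually.of_forall fun n => (abs_le.1 (bas_abs_le T φ n x)).2)
  have hup : ∀ r ∈ {r : ℝ | ∃ μ : Measure X, IsProbabilityMeasure μ ∧ μ.map T = μ ∧
      r = ∫ x, φ x ∂μ}, r ≤ ⨆ x : X, limsup (fun n : ℕ => birkhoffAvgSum T φ n x / n) atTop := by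
    rintro r ⟨μ, h1, h2, rfl⟩
    exact int_le T hT φ _ (fun x => le_ciSup hbdd x) μ h2
  unfold maxErgAvg
  apply le_antisymm
  · refine csSup_le ?_ hup
    obtain ⟨x⟩ := ‹Nonempty X›
    obtain ⟨μ, h1, h2, -⟩ := exists_inv T hT φ x _ (sub_one_lt _)
    exact ⟨_, μ, h1, h2, rfl⟩
  · refine ciSup_le fun x => le_of_forall_lt_imp_le_of_dense fun c hc => ?_
    obtain ⟨μ, h1, h2, h3⟩ := exists_inv T hT φ x c hc
    exact h3.trans (le_csSup ⟨_, hup⟩ ⟨μ, h1, h2, rfl⟩)
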